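/- There exists a closed set $E\subset\mathbb{R}$ (constructed as a self-similar-type union with dilation factors $t_n=1-\frac{1}{2n}$) such that for every $0<\alpha<1$ and every $1<p<\infty$, the weight $\operatorname{dist}(\cdot,E)^{-\alpha}$ belongs to $A_p(\mathbb{R})$ but not to $A_1(\mathbb{R})$; consequently $E$ is not weakly porous and $\Mu(E)=0$. -/

import Mathlib

open MeasureTheory Metric Set

noncomputable section

/-- A half-open interval ("cube") in `ℝ`, given by its left endpoint and length. -/
structure Seg where
  a : ℝ
  l : ℝ
  pos : 0 < l

/-- The set of points of an interval. -/
def Seg.set (P : Seg) : Set ℝ := Set.Ico P.a (P.a + P.l)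

/-- `Q` is a dyadic subinterval of `P`. -/
def IsDyadicSubseg (P Q : Seg) : Prop :=
  ∃ j k : ℕ, k < 2 ^ j ∧ Q.l = P.l / 2 ^ j ∧ Q.a = P.a + P.l * k / 2 ^ j

/-- An interval is `E`-free if it does not meet `E`. -/
def SegFree (E : Set ℝ) (Q : Seg) : Prop := Q.set ∩ E = ∅

/-- The measure `|𝓜(P)|` of a largest `E`-free dyadic subinterval of `P`
(`0` if there is none). -/
def maxFreeR (E : Set ℝ) (P : Seg) : ℝ :=
  sSup {v : ℝ | ∃ Q : Seg, IsDyadicSubseg P Q ∧ SegFree E Q ∧ v = (volume Q.set).toReal}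

/-- Weak porosity in `ℝ` with constants `c`, `δ`. -/
def WeaklyPorousWithR (E : Set ℝ) (c δ : ℝ) : Prop :=
  ∀ P : Seg, ∃ (N : ℕ) (Q : Fin N → Seg),
    (∀ k, IsDyadicSubseg P (Q k) ∧ SegFree E (Q k)) ∧
    (∀ k m, k ≠ m → Disjoint (Q k).set (Q m).set) ∧
    (∀ k, δ * maxFreeR E P ≤ (volume (Q k).set).toReal) ∧
    c * (volume P.set).toReal ≤ ∑ k, (volume (Q k).set).toReal

/-- A subset of `ℝ` is weakly porous. -/
def WeaklyPorousR (E : Set ℝ) : Prop :=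
  ∃ c δ : ℝ, 0 < c ∧ c < 1 ∧ 0 < δ ∧ δ < 1 ∧ WeaklyPorousWithR E c δ

/-- A weight on `ℝ`: locally integrable and a.e. positive. -/
def IsWeightR (w : ℝ → ℝ) : Prop :=
  LocallyIntegrable w volume ∧ ∀ᵐ x : ℝ, 0 < w x

/-- The `A₁` inequality over all intervals, with constant `C`. -/
def A1WithR (w : ℝ → ℝ) (C : ℝ) : Prop :=
  ∀ P : Seg, (⨍ x in P.set, w x) ≤ C * essInf w (volume.restrict P.set)

/-- Membership in `A₁(ℝ)`. -/
def MemA1R (w : ℝ → ℝ) : Prop := IsWeightR w ∧ ∃ C : ℝ, A1WithR w C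

/-- The `A_p` inequality over all intervals, with constant `C`. -/
def ApWithR (w : ℝ → ℝ) (p C : ℝ) : Prop :=
  ∀ P : Seg, (⨍ x in P.set, w x) * (⨍ x in P.set, w x ^ (1 / (1 - p))) ^ (p - 1) ≤ C

/-- Membership in `A_p(ℝ)`. -/
def MemApR (w : ℝ → ℝ) (p : ℝ) : Prop := IsWeightR w ∧ ∃ C : ℝ, ApWithR w p C

/-- `h_E(B(x,R))`: the supremum of radii `t` of balls contained in `B(x,R) \ E`. -/
def hFreeR (E : Set ℝ) (x R : ℝ) : ℝ :=
  sSup {t : ℝ | ∃ y ∈ ball x R, ball y t ⊆ ball x R \ E}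

/-- The set of admissible exponents for the Muckenhoupt exponent. -/
def MuckSetR (E : Set ℝ) : Set ℝ :=
  {α : ℝ | ∃ C : ℝ, ∀ x ∈ E, ∀ R r : ℝ, 0 < r → r < hFreeR E x R → hFreeR E x R ≤ R →
    (volume (thickening r E ∩ ball x R)).toReal ≤
      C * (hFreeR E x R / r) ^ (-α) * (volume (ball x R)).toReal}

open scoped Classical in
/-- The Muckenhoupt exponent of `E ⊆ ℝ`. -/
def MuckExpR (E : Set ℝ) : ℝ :=
  if ∀ x ∈ E, ∀ R : ℝ, 0 < R → 0 < hFreeR E x R then sSup (MuckSetR E) else 0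

end

/-- Each layer `k` is the grid `2⁻ᵏ ℤ` restricted to `|x| + 2 ≥ 2 ^ 2 ^ k`. -/
def sparseLayer (k : ℕ) : Set ℝ :=
  {x | (2 : ℝ) ^ 2 ^ k ≤ |x| + 2} ∩ (fun x => 2 ^ k * x) ⁻¹' range ((↑) : ℤ → ℝ)

/-- A closed set of isolated points whose gaps shrink logarithmically slowly at infinity. -/
def sparseSet : Set ℝ := ⋃ k, sparseLayer k

lemma nat_le_two_pow_two_pow (k : ℕ) : (k : ℝ) ≤ 2 ^ 2 ^ k := by
  have h : k < 2 ^ 2 ^ k := k.lt_two_pow_self.trans (2 ^ k).lt_two_pow_self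
  exact_mod_cast h.le

lemma two_pow_two_pow_mono {i j : ℕ} (h : i ≤ j) : (2 : ℝ) ^ 2 ^ i ≤ 2 ^ 2 ^ j :=
  pow_le_pow_right₀ one_le_two (Nat.pow_le_pow_right two_pos h)

lemma two_pow_two_pow_succ (k : ℕ) : (2 : ℝ) ^ 2 ^ (k + 1) = 2 ^ 2 ^ k * 2 ^ 2 ^ k := by
  rw [pow_succ, pow_mul, sq]

lemma two_le_two_pow_two_pow (k : ℕ) : (2 : ℝ) ≤ 2 ^ 2 ^ k := by
  simpa using two_pow_two_pow_mono (Nat.zero_le k)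

lemma isClosed_sparseSet : IsClosed sparseSet := by
  refine LocallyFinite.isClosed_iUnion (fun x => ⟨ball x 1, ball_mem_nhds x one_pos, ?_⟩)
    fun k => ?_
  · refine (Set.finite_Iic ⌈|x| + 3⌉₊).subset ?_
    rintro k ⟨y, ⟨hy, -⟩, hyx⟩
    have h1 : |y| ≤ |x| + 1 := by
      rw [mem_ball, Real.dist_eq] at hyx
      have := abs_sub_abs_le_abs_sub y x
      linarith
    have h2 : (2 : ℝ) ^ 2 ^ k ≤ |y| + 2 := hy
    have h3 := nat_le_two_pow_two_pow k
    have h4 := Nat.le_ceil (|x| + 3)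
    exact_mod_cast (by linarith : (k : ℝ) ≤ ⌈|x| + 3⌉₊)
  · exact (isClosed_le continuous_const (by fun_prop)).inter
      (Int.isClosedEmbedding_coe_real.isClosed_range.preimage (by fun_prop))

lemma mem_sparseSet {x : ℝ} :
    x ∈ sparseSet ↔ ∃ k : ℕ, (2 : ℝ) ^ 2 ^ k ≤ |x| + 2 ∧ ∃ j : ℤ, (j : ℝ) = 2 ^ k * x := by
  simp [sparseSet, sparseLayer]

lemma intCast_mem_sparseSet (j : ℤ) : (j : ℝ) ∈ sparseSet :=
  mem_sparseSet.2 ⟨0, by simp, j, by simp⟩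

lemma zero_mem_sparseSet : (0 : ℝ) ∈ sparseSet := by
  simpa using intCast_mem_sparseSet 0

lemma exists_int_eq_of_mem_sparseSet {x : ℝ} {k : ℕ} (hx : x ∈ sparseSet)
    (hk : |x| + 2 < 2 ^ 2 ^ (k + 1)) : ∃ j : ℤ, (j : ℝ) = 2 ^ k * x := by
  obtain ⟨i, hi, j, hj⟩ := mem_sparseSet.1 hx
  have hik : i ≤ k := by
    by_contra! h
    linarith [two_pow_two_pow_mono (show k + 1 ≤ i from h)]
  refine ⟨2 ^ (k - i) * j, ?_⟩
  push_cast
  rw [hj, ← mul_assoc, ← pow_add, Nat.sub_add_cancel hik]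

lemma exists_mem_sparseSet_right {x : ℝ} {k : ℕ} (hx : 0 ≤ x) (hk : (2 : ℝ) ^ 2 ^ k ≤ x + 2) :
    ∃ e ∈ sparseSet, x ≤ e ∧ e < x + 1 / 2 ^ k := by
  have h2 : (0 : ℝ) < 2 ^ k := by positivity
  have h3 : x ≤ ⌈2 ^ k * x⌉ / 2 ^ k := by
    rw [le_div_iff₀ h2, mul_comm]
    exact Int.le_ceil _
  refine ⟨⌈2 ^ k * x⌉ / 2 ^ k, mem_sparseSet.2 ⟨k, ?_, ⌈2 ^ k * x⌉, ?_⟩, h3, ?_⟩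
  · rw [abs_of_nonneg (hx.trans h3)]
    linarith
  · field_simp
  · rw [div_lt_iff₀ h2, add_mul, one_div, inv_mul_cancel₀ h2.ne', mul_comm]
    exact Int.ceil_lt_add_one _

lemma neg_mem_sparseSet {x : ℝ} (hx : x ∈ sparseSet) : -x ∈ sparseSet := by
  obtain ⟨i, hi, j, hj⟩ := mem_sparseSet.1 hx
  exact mem_sparseSet.2 ⟨i, by simpa using hi, -j, by push_cast; rw [hj]; ring⟩

lemma infDist_sparseSet_lt {x : ℝ} {k : ℕ} (hk : (2 : ℝ) ^ 2 ^ k ≤ |x| + 2) :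
    infDist x sparseSet < 1 / 2 ^ k := by
  obtain ⟨e, he, h1, h2⟩ := exists_mem_sparseSet_right (abs_nonneg x) hk
  have hd : |(|x|) - e| < 1 / 2 ^ k := by
    rw [abs_lt]
    constructor <;> linarith
  rcases abs_choice x with h | h
  · rw [h] at hd
    exact (infDist_le_dist_of_mem he).trans_lt hd
  · refine (infDist_le_dist_of_mem (neg_mem_sparseSet he)).trans_lt ?_
    rw [h] at hd
    rwa [Real.dist_eq, sub_neg_eq_add, ← abs_neg, neg_add']

lemma infDist_sparseSet_lt_one (x : ℝ) : infDist x sparseSet < 1 := by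
  simpa using infDist_sparseSet_lt (x := x) (k := 0) (by simp)

lemma countable_sparseSet : sparseSet.Countable := by
  refine countable_iUnion fun k => ?_
  refine ((countable_range ((↑) : ℤ → ℝ)).preimage_of_injOn ?_).mono inter_subset_right
  exact (mul_right_injective₀ (by positivity)).injOn

lemma infDist_sparseSet_pos {x : ℝ} (hx : x ∉ sparseSet) : 0 < infDist x sparseSet :=
  (isClosed_sparseSet.notMem_iff_infDist_pos ⟨0, zero_mem_sparseSet⟩).1 hx

lemma ae_notMem_sparseSet : ∀ᵐ x : ℝ, x ∉ sparseSet :=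
  countable_sparseSet.ae_notMem volume

lemma notMem_sparseSet_of_mem_Ioo {x : ℝ} (hx : x ∈ Ioo (0 : ℝ) 1) : x ∉ sparseSet := by
  intro h
  obtain ⟨j, hj⟩ := exists_int_eq_of_mem_sparseSet (k := 0) h (by
    rw [abs_of_pos hx.1]; norm_num; linarith [hx.2])
  rw [pow_zero, one_mul] at hj
  rw [← hj] at hx
  have h0 : (0 : ℤ) < j := by exact_mod_cast hx.1
  have h1 : j < 1 := by exact_mod_cast hx.2
  omega

/-- The power `t ^ (-α)` truncated to `t ≤ ρ`. -/
noncomputable def truncRpow (α ρ : ℝ) : ℝ → ℝ := (Iic ρ).indicator fun t => t ^ (-α)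

lemma integral_truncRpow_abs {α ρ : ℝ} (hα : α < 1) (hρ : 0 < ρ) :
    ∫ x, truncRpow α ρ |x| = 2 * (ρ ^ (1 - α) / (1 - α)) := by
  rw [integral_comp_abs, truncRpow, setIntegral_indicator measurableSet_Iic, Ioi_inter_Iic,
    ← intervalIntegral.integral_of_le hρ.le, integral_rpow (Or.inl (by linarith)),
    Real.zero_rpow (by linarith), sub_zero, neg_add_eq_sub]

lemma integrable_truncRpow_abs {α ρ : ℝ} (hα : α < 1) (hρ : 0 < ρ) :
    Integrable fun x => truncRpow α ρ |x| := by
  refine not_imp_comm.1 integral_undef ?_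
  rw [integral_truncRpow_abs hα hρ]
  have : 0 < 1 - α := by linarith
  positivity

lemma truncRpow_nonneg (α ρ : ℝ) {t : ℝ} (ht : 0 ≤ t) : 0 ≤ truncRpow α ρ t := by
  rw [truncRpow, indicator_apply]
  split_ifs
  · exact Real.rpow_nonneg ht _
  · exact le_rfl

lemma measurable_infDist_rpow (E : Set ℝ) (β : ℝ) : Measurable fun x => infDist x E ^ β :=
  (continuous_infDist_pt E).measurable.pow_const β

lemma infDist_rpow_neg_le {E : Set ℝ} (hE : IsClosed E) (hne : E.Nonempty) {α ρ a b : ℝ}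
    (hα : 0 < α) (hρ : 0 < ρ) (F : Finset ℝ)
    (hF : ∀ e ∈ E, a - ρ ≤ e → e ≤ b + ρ → e ∈ F) {x : ℝ} (hx : x ∈ Ico a b) :
    infDist x E ^ (-α) ≤ ρ ^ (-α) + ∑ e ∈ F, truncRpow α ρ |x - e| := by
  have hnn : ∀ e ∈ F, 0 ≤ truncRpow α ρ |x - e| := fun e _ => truncRpow_nonneg _ _ (abs_nonneg _)
  rcases le_or_gt ρ (infDist x E) with h | h
  · have h1 := Real.rpow_le_rpow_of_nonpos hρ h (neg_nonpos.2 hα.le)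
    linarith [Finset.sum_nonneg hnn]
  · obtain ⟨e, he, hd⟩ := hE.exists_infDist_eq_dist hne x
    rw [Real.dist_eq] at hd
    have hxe : |x - e| < ρ := hd ▸ h
    have heF : e ∈ F := by
      rw [abs_lt] at hxe
      exact hF e he (by linarith [hx.1]) (by linarith [hx.2])
    have h1 := Finset.single_le_sum hnn heF
    have h2 : truncRpow α ρ |x - e| = infDist x E ^ (-α) := by
      rw [truncRpow, indicator_of_mem (mem_Iic.2 hxe.le), hd]
    have := Real.rpow_nonneg hρ.le (-α)
    linarith

lemma integrableOn_infDist_rpow_neg {E : Set ℝ} (hE : IsClosed E) (hne : E.Nonempty)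
    {α ρ a b : ℝ} (hα : 0 < α) (hα1 : α < 1) (hρ : 0 < ρ) (F : Finset ℝ)
    (hF : ∀ e ∈ E, a - ρ ≤ e → e ≤ b + ρ → e ∈ F) :
    IntegrableOn (fun x => infDist x E ^ (-α)) (Ico a b) := by
  have hint : IntegrableOn (fun x => ρ ^ (-α) + ∑ e ∈ F, truncRpow α ρ |x - e|) (Ico a b) :=
    (integrableOn_const (by simp)).add (integrable_finsetSum _ fun e _ =>
      ((integrable_truncRpow_abs hα1 hρ).comp_sub_right e).integrableOn)
  refine Integrable.mono' hint (measurable_infDist_rpow E _).aestronglyMeasurable ?_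
  filter_upwards [ae_restrict_mem measurableSet_Ico] with x hx
  rw [Real.norm_of_nonneg (Real.rpow_nonneg infDist_nonneg _)]
  exact infDist_rpow_neg_le hE hne hα hρ F hF hx

lemma setIntegral_infDist_rpow_neg_le {E : Set ℝ} (hE : IsClosed E) (hne : E.Nonempty)
    {α ρ a b : ℝ} (hα : 0 < α) (hα1 : α < 1) (hρ : 0 < ρ) (hab : a ≤ b) (F : Finset ℝ)
    (hF : ∀ e ∈ E, a - ρ ≤ e → e ≤ b + ρ → e ∈ F) :
    ∫ x in Ico a b, infDist x E ^ (-α) ≤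
      ρ ^ (-α) * (b - a) + F.card * (2 * (ρ ^ (1 - α) / (1 - α))) := by
  have hi : ∀ e ∈ F, Integrable fun x => truncRpow α ρ |x - e| := fun e _ =>
    (integrable_truncRpow_abs hα1 hρ).comp_sub_right e
  have hc : IntegrableOn (fun _ : ℝ => ρ ^ (-α)) (Ico a b) := integrableOn_const (by simp)
  calc ∫ x in Ico a b, infDist x E ^ (-α)
      ≤ ∫ x in Ico a b, (ρ ^ (-α) + ∑ e ∈ F, truncRpow α ρ |x - e|) :=
        setIntegral_mono_on (integrableOn_infDist_rpow_neg hE hne hα hα1 hρ F hF)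
          (hc.add (integrable_finsetSum _ fun e he => (hi e he).integrableOn)) measurableSet_Ico
          fun x hx => infDist_rpow_neg_le hE hne hα hρ F hF hx
    _ = ρ ^ (-α) * (b - a) + ∑ e ∈ F, ∫ x in Ico a b, truncRpow α ρ |x - e| := by
        rw [integral_add hc (integrable_finsetSum _ fun e he => (hi e he).integrableOn),
          integral_finsetSum _ fun e he => (hi e he).integrableOn]
        simp [hab, mul_comm]
    _ ≤ ρ ^ (-α) * (b - a) + ∑ e ∈ F, ∫ x, truncRpow α ρ |x - e| := by
        gcongr with e he
        · exact Filter.Eventually.of_forall fun x => truncRpow_nonneg _ _ (abs_nonneg _)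
        · exact hi e he
        · exact Measure.restrict_le_self
    _ = _ := by
        congr 1
        rw [Finset.sum_congr rfl fun e _ => (integral_sub_right_eq_self
          (fun x => truncRpow α ρ |x|) e).trans (integral_truncRpow_abs hα1 hρ)]
        simp

lemma exists_finset_sparseSet {a b ρ : ℝ} {k : ℕ} (hab : a - ρ ≤ b + ρ)
    (hk : max |a| |b| + ρ + 2 < 2 ^ 2 ^ (k + 1)) :
    ∃ F : Finset ℝ, (∀ e ∈ sparseSet, a - ρ ≤ e → e ≤ b + ρ → e ∈ F) ∧
      (F.card : ℝ) ≤ 2 ^ k * (b - a + 2 * ρ) + 1 := by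
  have h2 : (0 : ℝ) < 2 ^ k := by positivity
  refine ⟨(Finset.Icc ⌈2 ^ k * (a - ρ)⌉ ⌊2 ^ k * (b + ρ)⌋).image fun j : ℤ => (j : ℝ) / 2 ^ k,
    fun e he h1 h3 => ?_, ?_⟩
  · have hmax : |e| + 2 < 2 ^ 2 ^ (k + 1) := by
      have h4 : |e| ≤ max |a| |b| + ρ := by
        rw [abs_le]
        constructor
        · linarith [le_max_left |a| |b|, neg_abs_le a]
        · linarith [le_max_right |a| |b|, le_abs_self b]
      linarith
    obtain ⟨j, hj⟩ := exists_int_eq_of_mem_sparseSet he hmax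
    refine Finset.mem_image.2 ⟨j, Finset.mem_Icc.2 ⟨Int.ceil_le.2 ?_, Int.le_floor.2 ?_⟩, ?_⟩
    · rw [hj]; gcongr
    · rw [hj]; gcongr
    · rw [hj]; field_simp
  · refine (Nat.cast_le.2 Finset.card_image_le).trans ?_
    rw [Int.card_Icc]
    have h5 : ((⌊2 ^ k * (b + ρ)⌋ + 1 - ⌈2 ^ k * (a - ρ)⌉ : ℤ) : ℝ) ≤
        2 ^ k * (b - a + 2 * ρ) + 1 := by
      push_cast
      linarith [Int.floor_le (2 ^ k * (b + ρ)), Int.le_ceil (2 ^ k * (a - ρ))]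
    have h6 : 0 ≤ 2 ^ k * (b - a + 2 * ρ) + 1 := by
      have := mul_nonneg h2.le (by linarith : 0 ≤ b - a + 2 * ρ)
      linarith
    rcases le_total 0 (⌊2 ^ k * (b + ρ)⌋ + 1 - ⌈2 ^ k * (a - ρ)⌉) with h | h
    · rw [← Int.toNat_of_nonneg h] at h5
      exact_mod_cast h5
    · rw [Int.toNat_of_nonpos h]
      exact_mod_cast h6

lemma locallyIntegrable_infDist_sparseSet {α : ℝ} (hα : 0 < α) (hα1 : α < 1) :
    LocallyIntegrable fun x => infDist x sparseSet ^ (-α) := by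
  intro x
  obtain ⟨F, hF, -⟩ := exists_finset_sparseSet (a := x - 1) (b := x + 1) (ρ := 1)
    (k := ⌈|x| + 4⌉₊) (by linarith) (by
      have h1 := nat_le_two_pow_two_pow (⌈|x| + 4⌉₊ + 1)
      have h2 := Nat.le_ceil (|x| + 4)
      have h3 : max |x - 1| |x + 1| ≤ |x| + 1 :=
        max_le ((abs_sub _ _).trans (by simp)) ((abs_add_le _ _).trans (by simp))
      push_cast at h1
      linarith)
  exact ⟨Ico (x - 1) (x + 1), Ico_mem_nhds (by linarith) (by linarith),
    integrableOn_infDist_rpow_neg isClosed_sparseSet ⟨0, zero_mem_sparseSet⟩ hα hα1 one_pos F hF⟩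

lemma isWeightR_infDist_sparseSet {α : ℝ} (hα : 0 < α) (hα1 : α < 1) :
    IsWeightR fun x => infDist x sparseSet ^ (-α) := by
  refine ⟨locallyIntegrable_infDist_sparseSet hα hα1, ?_⟩
  filter_upwards [ae_notMem_sparseSet] with x hx
  exact Real.rpow_pos_of_pos (infDist_sparseSet_pos hx) _

lemma setIntegral_infDist_sparseSet_rpow_neg_le {α ρ a b : ℝ} {k : ℕ} (hα : 0 < α) (hα1 : α < 1)
    (hρ : 0 < ρ) (hρk : 2 ^ k * ρ ≤ 1) (hρab : ρ ≤ b - a)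
    (hk : max |a| |b| + 2 ≤ 2 ^ 2 ^ k) :
    ∫ x in Ico a b, infDist x sparseSet ^ (-α) ≤
      (1 + 8 / (1 - α)) * ρ ^ (-α) * (b - a) := by
  have hρ1 : ρ ≤ 1 := by
    have : (1 : ℝ) ≤ 2 ^ k := one_le_pow₀ one_le_two
    nlinarith
  obtain ⟨F, hF, hcard⟩ := exists_finset_sparseSet (a := a) (b := b) (ρ := ρ) (k := k)
    (by linarith) (by
      rw [two_pow_two_pow_succ]
      nlinarith [two_le_two_pow_two_pow k])
  refine (setIntegral_infDist_rpow_neg_le isClosed_sparseSet ⟨0, zero_mem_sparseSet⟩ hα hα1 hρ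
    (by linarith) F hF).trans ?_
  have h1 : 0 < 1 - α := by linarith
  have h2 : ρ ^ (1 - α) = ρ * ρ ^ (-α) := by
    rw [sub_eq_add_neg, Real.rpow_add hρ, Real.rpow_one]
  have h3 : (F.card : ℝ) * ρ ≤ 4 * (b - a) := by
    have h4 := mul_le_mul_of_nonneg_right hcard hρ.le
    have h5 := mul_le_mul_of_nonneg_right hρk (by linarith : 0 ≤ b - a + 2 * ρ)
    nlinarith
  have h6 : 0 < ρ ^ (-α) := Real.rpow_pos_of_pos hρ _
  calc ρ ^ (-α) * (b - a) + F.card * (2 * (ρ ^ (1 - α) / (1 - α)))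
      = ρ ^ (-α) * (b - a) + 2 * ρ ^ (-α) / (1 - α) * (F.card * ρ) := by rw [h2]; ring
    _ ≤ ρ ^ (-α) * (b - a) + 2 * ρ ^ (-α) / (1 - α) * (4 * (b - a)) := by gcongr
    _ = _ := by ring

lemma exists_two_pow_rpow_le (β : ℝ) :
    ∃ C : ℝ, 0 ≤ C ∧ ∀ m : ℕ, ((2 : ℝ) ^ m) ^ β ≤ C * 2 ^ 2 ^ m := by
  have h := (tendsto_rpow_mul_exp_neg_mul_atTop_nhds_zero β (Real.log 2)
    (Real.log_pos one_lt_two)).comp (tendsto_pow_atTop_atTop_of_one_lt (one_lt_two (α := ℝ)))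
  obtain ⟨C, hC⟩ := h.bddAbove_range
  have hC' : ∀ m : ℕ, ((2 : ℝ) ^ m) ^ β ≤ C * 2 ^ 2 ^ m := fun m => by
    have h1 := hC (mem_range_self m)
    have h2 : Real.exp (Real.log 2 * 2 ^ m) = 2 ^ 2 ^ m := by
      rw [← Real.rpow_def_of_pos two_pos, ← Real.rpow_natCast 2 (2 ^ m)]
      push_cast
      rfl
    rw [Function.comp_apply, neg_mul, Real.exp_neg, h2, ← div_eq_mul_inv,
      div_le_iff₀ (by positivity)] at h1
    exact h1
  refine ⟨C, ?_, hC'⟩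
  by_contra! hneg
  have h3 := hC' 0
  simp at h3
  linarith

lemma volume_real_small_le {a b : ℝ} {m : ℕ} (hab : a ≤ b)
    (hk : (2 : ℝ) ^ 2 ^ (m + 1) < max |a| |b| + 2) :
    volume.real ({x : ℝ | |x| + 2 < 2 ^ 2 ^ m} ∩ Ico a b) ≤ 4 / 2 ^ 2 ^ m * (b - a) := by
  rcases ({x : ℝ | |x| + 2 < 2 ^ 2 ^ m} ∩ Ico a b).eq_empty_or_nonempty with h | ⟨z, hz, hz1, hz2⟩
  · rw [h, measureReal_empty]
    have : 0 ≤ b - a := by linarith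
    positivity
  · rw [two_pow_two_pow_succ] at hk
    set M : ℝ := 2 ^ 2 ^ m
    have hM : 2 ≤ M := two_le_two_pow_two_pow m
    have hz' : |z| + 2 < M := hz
    have h1 : max |a| |b| - |z| ≤ b - a := by
      rcases max_choice |a| |b| with h | h <;> rw [h]
      · have := abs_sub_abs_le_abs_sub a z
        rw [abs_of_nonpos (by linarith : a - z ≤ 0)] at this
        linarith
      · have := abs_sub_abs_le_abs_sub b z
        rw [abs_of_nonneg (by linarith : 0 ≤ b - z)] at this
        linarith
    have h2 : volume.real ({x : ℝ | |x| + 2 < M} ∩ Ico a b) ≤ 2 * M := by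
      calc volume.real ({x : ℝ | |x| + 2 < M} ∩ Ico a b) ≤ volume.real (Ioo (-M) M) := by
            refine measureReal_mono ?_ measure_Ioo_lt_top.ne
            rintro x ⟨hx, -⟩
            have hx' : |x| + 2 < M := hx
            exact abs_lt.1 (by linarith)
        _ = 2 * M := by rw [Real.volume_real_Ioo_of_le (by linarith)]; ring
    refine h2.trans ?_
    rw [div_mul_eq_mul_div, le_div_iff₀ (by linarith)]
    nlinarith

lemma exists_setIntegral_infDist_sparseSet_rpow_le {β : ℝ} (hβ : 0 < β) :
    ∃ C : ℝ, 0 ≤ C ∧ ∀ (a b : ℝ) (k : ℕ), a ≤ b →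
      (∀ j < k, (2 : ℝ) ^ 2 ^ j < max |a| |b| + 2) →
      ∫ x in Ico a b, infDist x sparseSet ^ β ≤ C * (1 / 2 ^ k) ^ β * (b - a) := by
  obtain ⟨C, hC0, hC⟩ := exists_two_pow_rpow_le β
  have hint : ∀ a b : ℝ, IntegrableOn (fun x => infDist x sparseSet ^ β) (Ico a b) := fun a b =>
    (((continuous_infDist_pt _).rpow_const fun _ => Or.inr hβ.le).integrableOn_Icc).mono_set
      Ico_subset_Icc_self
  refine ⟨4 ^ β + 4 * C * 4 ^ β, by positivity, fun a b k hab hk => ?_⟩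
  rcases le_or_gt k 2 with hk2 | hk2
  · have h1 : ∀ x ∈ Ico a b, infDist x sparseSet ^ β ≤ (4 * (1 / 2 ^ k)) ^ β := fun x _ => by
      refine Real.rpow_le_rpow infDist_nonneg ((infDist_sparseSet_lt_one x).le.trans ?_) hβ.le
      have : (2 : ℝ) ^ k ≤ 2 ^ 2 := pow_le_pow_right₀ one_le_two hk2
      rw [mul_one_div, le_div_iff₀ (by positivity)]
      linarith
    have h2 := setIntegral_mono_on (hint a b)
      (integrableOn_const (C := (4 * (1 / 2 ^ k) : ℝ) ^ β) (by simp)) measurableSet_Ico h1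
    refine h2.trans ?_
    rw [setIntegral_const, Real.volume_real_Ico_of_le hab, smul_eq_mul, mul_comm,
      Real.mul_rpow (by norm_num) (by positivity)]
    have : 0 ≤ b - a := by linarith
    gcongr
    have : 0 ≤ 4 * C * 4 ^ β := by positivity
    linarith
  obtain ⟨m, rfl⟩ : ∃ m, k = m + 2 := ⟨k - 2, by omega⟩
  set S : Set ℝ := {x : ℝ | |x| + 2 < 2 ^ 2 ^ m}
  have hS : MeasurableSet S := measurableSet_lt (by fun_prop) measurable_const
  have hu : (1 / 2 ^ m : ℝ) = 4 * (1 / 2 ^ (m + 2)) := by rw [pow_add]; field_simp; norm_num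
  have h1 : ∀ x ∈ Ico a b, infDist x sparseSet ^ β ≤
      (1 / 2 ^ m) ^ β + S.indicator (fun _ => 1) x := fun x _ => by
    by_cases hx : x ∈ S
    · rw [indicator_of_mem hx]
      have := Real.rpow_le_one infDist_nonneg (infDist_sparseSet_lt_one x).le hβ.le
      have : (0 : ℝ) ≤ (1 / 2 ^ m) ^ β := by positivity
      linarith
    · rw [indicator_of_notMem hx, add_zero]
      exact Real.rpow_le_rpow infDist_nonneg (infDist_sparseSet_lt (not_lt.1 hx)).le hβ.le
  have hc : IntegrableOn (fun _ : ℝ => (1 / 2 ^ m : ℝ) ^ β) (Ico a b) :=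
    integrableOn_const (by simp)
  have hi : IntegrableOn (S.indicator fun _ => (1 : ℝ)) (Ico a b) :=
    (integrableOn_const (by simp)).indicator hS
  have h2 := setIntegral_mono_on (hint a b) (hc.add hi) measurableSet_Ico h1
  refine h2.trans ?_
  rw [integral_add' hc hi, setIntegral_const, Real.volume_real_Ico_of_le hab,
    integral_indicator_const _ hS, measureReal_restrict_apply hS, smul_eq_mul, smul_eq_mul, mul_one]
  have h3 := volume_real_small_le (m := m) hab (hk (m + 1) (by omega))
  have h4 : 4 / (2 : ℝ) ^ 2 ^ m ≤ 4 * C * (1 / 2 ^ m) ^ β := by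
    have h5 := hC m
    rw [Real.div_rpow zero_le_one (by positivity), Real.one_rpow, mul_one_div,
      div_le_div_iff₀ (by positivity) (by positivity)]
    nlinarith
  calc (b - a) * (1 / 2 ^ m) ^ β + volume.real (S ∩ Ico a b)
      ≤ (b - a) * (1 / 2 ^ m) ^ β + 4 * C * (1 / 2 ^ m) ^ β * (b - a) := by
        have : 0 ≤ b - a := by linarith
        have := mul_le_mul_of_nonneg_right h4 this
        linarith
    _ = (4 ^ β + 4 * C * 4 ^ β) * (1 / 2 ^ (m + 2)) ^ β * (b - a) := by
        rw [hu, Real.mul_rpow (by norm_num) (by positivity)]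
        ring

lemma Seg.average_le {P : Seg} {f : ℝ → ℝ} {C : ℝ} (h : ∫ x in P.set, f x ≤ C * P.l) :
    (⨍ x in P.set, f x) ≤ C := by
  have hP : volume.real P.set = P.l := by
    rw [Seg.set, Real.volume_real_Ico_of_le (by linarith [P.pos])]; ring
  rw [setAverage_eq, hP, smul_eq_mul, ← div_eq_inv_mul, div_le_iff₀ P.pos]
  exact h

lemma Seg.average_le_of_le {P : Seg} {f : ℝ → ℝ} {C : ℝ} (h0 : ∀ x ∈ P.set, 0 ≤ f x)
    (h : ∀ x ∈ P.set, f x ≤ C) : (⨍ x in P.set, f x) ≤ C := by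
  refine P.average_le ((le_abs_self _).trans ?_)
  have h1 := norm_setIntegral_le_of_norm_le_const (μ := volume) (s := P.set) measure_Ico_lt_top
    fun x hx => (Real.norm_of_nonneg (h0 x hx)).trans_le (h x hx)
  have hP : volume.real P.set = P.l := by
    rw [Seg.set, Real.volume_real_Ico_of_le (by linarith [P.pos])]; ring
  rwa [hP] at h1

lemma Seg.average_nonneg {P : Seg} {f : ℝ → ℝ} (h : ∀ x, 0 ≤ f x) :
    0 ≤ ⨍ x in P.set, f x := by
  rw [setAverage_eq]
  exact smul_nonneg (inv_nonneg.2 measureReal_nonneg) (integral_nonneg h)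

lemma exists_average_mul_average_sparseSet_le {α β q : ℝ} (hα : 0 < α) (hα1 : α < 1) (hβ : 0 < β)
    (hq : 0 < q) (hβq : β * q = α) :
    ∃ C : ℝ, ∀ P : Seg, (⨍ x in P.set, infDist x sparseSet ^ (-α)) *
      (⨍ x in P.set, infDist x sparseSet ^ β) ^ q ≤ C := by
  obtain ⟨B, hB0, hB⟩ := exists_setIntegral_infDist_sparseSet_rpow_le hβ
  have hA0 : 0 ≤ 1 + 8 / (1 - α) := by
    have : 0 < 1 - α := by linarith
    positivity
  set A := 1 + 8 / (1 - α)
  have hD : ∀ γ x : ℝ, 0 ≤ infDist x sparseSet ^ γ := fun γ x => Real.rpow_nonneg infDist_nonneg _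
  refine ⟨4 ^ α + A * (2 ^ β + B) ^ q, fun P => ?_⟩
  have hnn := Real.rpow_nonneg (Seg.average_nonneg (P := P) (hD β)) q
  by_cases hfar : ∃ x₀ ∈ P.set, 2 * P.l ≤ infDist x₀ sparseSet
  · obtain ⟨x₀, hx₀, hd⟩ := hfar
    set d := infDist x₀ sparseSet
    have hd0 : 0 < d := by linarith [P.pos]
    have hdist : ∀ x ∈ P.set, dist x x₀ ≤ d / 2 := fun x hx => by
      rw [Real.dist_eq, abs_le]
      constructor <;> linarith [hx.1, hx.2, hx₀.1, hx₀.2]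
    have h1 : (⨍ x in P.set, infDist x sparseSet ^ (-α)) ≤ (d / 2) ^ (-α) := by
      refine Seg.average_le_of_le (fun x _ => hD _ x) fun x hx =>
        Real.rpow_le_rpow_of_nonpos (by positivity) ?_ (neg_nonpos.2 hα.le)
      have h3 : d ≤ infDist x sparseSet + dist x₀ x := infDist_le_infDist_add_dist
      rw [dist_comm] at h3
      linarith [hdist x hx]
    have h2 : (⨍ x in P.set, infDist x sparseSet ^ β) ≤ (2 * d) ^ β := by
      refine Seg.average_le_of_le (fun x _ => hD _ x) fun x hx =>
        Real.rpow_le_rpow infDist_nonneg ?_ hβ.le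
      have h3 : infDist x sparseSet ≤ d + dist x x₀ := infDist_le_infDist_add_dist
      linarith [hdist x hx]
    have h3 := mul_le_mul h1 (Real.rpow_le_rpow (Seg.average_nonneg (hD β)) h2 hq.le) hnn
      (by positivity)
    refine h3.trans ?_
    rw [← Real.rpow_mul (by positivity), hβq, Real.rpow_neg (by positivity), ← div_eq_inv_mul,
      ← Real.div_rpow (by positivity) (by positivity)]
    have h4 : 2 * d / (d / 2) = 4 := by field_simp; norm_num
    rw [h4]
    have : 0 ≤ A * (2 ^ β + B) ^ q := by positivity
    linarith
  · push Not at hfar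
    have hex : ∃ k : ℕ, max |P.a| |P.a + P.l| + 2 ≤ 2 ^ 2 ^ k :=
      ⟨⌈max |P.a| |P.a + P.l| + 2⌉₊, (Nat.le_ceil _).trans (nat_le_two_pow_two_pow _)⟩
    classical
    set k := Nat.find hex
    have hk := Nat.find_spec hex
    have hmin : ∀ j < k, (2 : ℝ) ^ 2 ^ j < max |P.a| |P.a + P.l| + 2 := fun j hj =>
      not_le.1 (Nat.find_min hex hj)
    have h2k : (0 : ℝ) < 2 ^ k := by positivity
    set ρ := min P.l (1 / 2 ^ k)
    have hρ : 0 < ρ := lt_min P.pos (by positivity)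
    have hl : P.a + P.l - P.a = P.l := by ring
    have h1 : (⨍ x in P.set, infDist x sparseSet ^ (-α)) ≤ A * ρ ^ (-α) := by
      refine Seg.average_le ?_
      have := setIntegral_infDist_sparseSet_rpow_neg_le (a := P.a) (b := P.a + P.l) (k := k) hα hα1
        hρ ?_ ?_ hk
      · rwa [hl] at this
      · rw [mul_comm, ← le_div_iff₀ h2k]
        exact min_le_right _ _
      · rw [hl]
        exact min_le_left _ _
    have h2 : (⨍ x in P.set, infDist x sparseSet ^ β) ≤ (2 ^ β + B) * ρ ^ β := by
      have hρβ : 0 < ρ ^ β := Real.rpow_pos_of_pos hρ _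
      rcases min_choice P.l (1 / 2 ^ k) with h | h
      · have h3 : (⨍ x in P.set, infDist x sparseSet ^ β) ≤ (2 * ρ) ^ β :=
          Seg.average_le_of_le (fun x _ => hD _ x) fun x hx =>
            Real.rpow_le_rpow infDist_nonneg
              ((hfar x hx).le.trans_eq (by rw [show ρ = P.l from h])) hβ.le
        rw [Real.mul_rpow two_pos.le hρ.le] at h3
        nlinarith
      · have h3 : (⨍ x in P.set, infDist x sparseSet ^ β) ≤ B * ρ ^ β := by
          refine Seg.average_le ?_
          have := hB P.a (P.a + P.l) k (by linarith [P.pos]) hmin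
          rwa [hl, ← h] at this
        have : 0 < (2 : ℝ) ^ β := by positivity
        nlinarith
    have h3 := mul_le_mul h1 (Real.rpow_le_rpow (Seg.average_nonneg (hD β)) h2 hq.le) hnn
      (by positivity)
    refine h3.trans ?_
    rw [Real.mul_rpow (by positivity) (by positivity), ← Real.rpow_mul hρ.le, hβq,
      Real.rpow_neg hρ.le]
    have h4 : 0 < ρ ^ α := Real.rpow_pos_of_pos hρ _
    calc A * (ρ ^ α)⁻¹ * ((2 ^ β + B) ^ q * ρ ^ α) = A * (2 ^ β + B) ^ q := by field_simp
      _ ≤ _ := by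
        have : (0 : ℝ) < 4 ^ α := by positivity
        linarith

lemma memApR_infDist_sparseSet {α p : ℝ} (hα : 0 < α) (hα1 : α < 1) (hp : 1 < p) :
    MemApR (fun x => infDist x sparseSet ^ (-α)) p := by
  have hp' : 0 < p - 1 := by linarith
  obtain ⟨C, hC⟩ := exists_average_mul_average_sparseSet_le hα hα1 (div_pos hα hp') hp'
    (div_mul_cancel₀ α hp'.ne')
  refine ⟨isWeightR_infDist_sparseSet hα hα1, C, fun P => ?_⟩
  convert hC P using 5 with x
  rw [← Real.rpow_mul infDist_nonneg]
  congr 1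
  rw [mul_one_div, ← neg_sub p 1, neg_div_neg_eq]

open Filter Topology in
lemma exists_lt_two_pow_rpow {α : ℝ} (hα : 0 < α) (K : ℝ) :
    ∃ k : ℕ, 2 ≤ k ∧ K < ((2 : ℝ) ^ k) ^ α :=
  ((eventually_ge_atTop 2).and (((tendsto_rpow_atTop hα).comp
    (tendsto_pow_atTop_atTop_of_one_lt (one_lt_two (α := ℝ)))).eventually_gt_atTop K)).exists

lemma quarter_le_infDist_sparseSet {x : ℝ} (hx : x ∈ Ioo (1 / 4 : ℝ) (3 / 4)) :
    1 / 4 ≤ infDist x sparseSet := by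
  refine (le_infDist ⟨0, zero_mem_sparseSet⟩).2 fun {e} he => ?_
  by_contra! h
  rw [Real.dist_eq, abs_lt] at h
  exact notMem_sparseSet_of_mem_Ioo ⟨by linarith [hx.1], by linarith [hx.2]⟩ he

lemma essInf_infDist_sparseSet_mem {α R : ℝ} (hα : 0 < α) (hR : 1 ≤ R) :
    essInf (fun x => infDist x sparseSet ^ (-α)) (volume.restrict (Ico 0 R)) ∈
      Icc 0 ((4 : ℝ) ^ α) := by
  rw [essInf, Filter.liminf_eq]
  have h0 : ∀ᵐ x ∂volume.restrict (Ico 0 R), 0 ≤ infDist x sparseSet ^ (-α) :=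
    Filter.Eventually.of_forall fun x => Real.rpow_nonneg infDist_nonneg _
  refine ⟨Real.sSup_nonneg' ⟨0, h0, le_rfl⟩, Real.sSup_le (fun a ha => ?_) (by positivity)⟩
  have hsub : Ioo (1 / 4 : ℝ) (3 / 4) ⊆ Ico 0 R := fun x hx =>
    ⟨by linarith [hx.1], by linarith [hx.2]⟩
  have h1 : ∀ᵐ x ∂volume.restrict (Ioo (1 / 4 : ℝ) (3 / 4)), a ≤ infDist x sparseSet ^ (-α) :=
    ae_restrict_of_ae_restrict_of_subset hsub ha
  have : (ae (volume.restrict (Ioo (1 / 4 : ℝ) (3 / 4)))).NeBot := by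
    rw [ae_restrict_neBot, Real.volume_Ioo]
    norm_num
  obtain ⟨x, hx1, hx2⟩ := (h1.and (ae_restrict_mem measurableSet_Ioo)).exists
  refine hx1.trans ?_
  have h2 := Real.rpow_le_rpow_of_nonpos (by norm_num) (quarter_le_infDist_sparseSet hx2)
    (neg_nonpos.2 hα.le)
  rwa [one_div, Real.inv_rpow (by norm_num), ← Real.rpow_neg (by norm_num), neg_neg] at h2

lemma not_memA1R_infDist_sparseSet {α : ℝ} (hα : 0 < α) :
    ¬ MemA1R (fun x => infDist x sparseSet ^ (-α)) := by
  rintro ⟨⟨hloc, -⟩, C, hC⟩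
  obtain ⟨k, -, hk⟩ := exists_lt_two_pow_rpow hα (2 * (|C| * 4 ^ α))
  set R : ℝ := 2 ^ 2 ^ k
  have hR : 2 ≤ R := two_le_two_pow_two_pow k
  let P : Seg := ⟨0, 2 * R, by linarith⟩
  have hPset : P.set = Ico 0 (2 * R) := by simp [P, Seg.set]
  have h1 := hC P
  rw [hPset] at h1
  have h2 := essInf_infDist_sparseSet_mem (R := 2 * R) hα (by linarith)
  have h3 : C * essInf (fun x => infDist x sparseSet ^ (-α)) (volume.restrict (Ico 0 (2 * R))) ≤
      |C| * 4 ^ α :=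
    mul_le_mul (le_abs_self C) h2.2 h2.1 (abs_nonneg C)
  have hint : IntegrableOn (fun x => infDist x sparseSet ^ (-α)) (Ico 0 (2 * R)) :=
    (hloc.integrableOn_isCompact isCompact_Icc).mono_set Ico_subset_Icc_self
  have hsub : Ico R (2 * R) ⊆ Ico 0 (2 * R) := Ico_subset_Ico_left (by linarith)
  have h4 : R * ((2 : ℝ) ^ k) ^ α ≤ ∫ x in Ico 0 (2 * R), infDist x sparseSet ^ (-α) := by
    calc R * ((2 : ℝ) ^ k) ^ α = ∫ x in Ico R (2 * R), ((2 : ℝ) ^ k) ^ α := by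
          rw [setIntegral_const, Real.volume_real_Ico_of_le (by linarith), smul_eq_mul]
          ring
      _ ≤ ∫ x in Ico R (2 * R), infDist x sparseSet ^ (-α) := by
          refine integral_mono_ae (integrableOn_const (by simp)) (hint.mono_set hsub) ?_
          filter_upwards [ae_restrict_mem measurableSet_Ico,
            ae_restrict_of_ae ae_notMem_sparseSet] with x hx hxE
          have h5 : infDist x sparseSet ≤ 1 / 2 ^ k := (infDist_sparseSet_lt (by
            rw [abs_of_nonneg (by linarith [hx.1])]
            linarith [hx.1])).le
          have h6 := Real.rpow_le_rpow_of_nonpos (infDist_sparseSet_pos hxE) h5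
            (neg_nonpos.2 hα.le)
          rwa [one_div, Real.inv_rpow (by positivity), Real.rpow_neg (by positivity),
            inv_inv] at h6
      _ ≤ _ := setIntegral_mono_set hint (Filter.Eventually.of_forall fun x =>
          Real.rpow_nonneg infDist_nonneg _) hsub.eventuallyLE
  rw [setAverage_eq, Real.volume_real_Ico_of_le (by linarith), smul_eq_mul, ← div_eq_inv_mul,
    div_le_iff₀ (by linarith)] at h1
  have h7 := mul_le_mul_of_nonneg_right h3 (by linarith : 0 ≤ 2 * R - 0)
  nlinarith

lemma not_weaklyPorousR_sparseSet : ¬ WeaklyPorousR sparseSet := by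
  rintro ⟨c, δ, hc, -, hδ, -, h⟩
  obtain ⟨k, -, hk⟩ := exists_lt_two_pow_rpow one_pos (2 / δ)
  rw [Real.rpow_one, div_lt_iff₀ hδ] at hk
  set R : ℝ := 2 ^ 2 ^ k
  obtain ⟨K, -, hK⟩ := exists_lt_two_pow_rpow one_pos ((R + 1) / c)
  rw [Real.rpow_one, div_lt_iff₀ hc] at hK
  let P : Seg := ⟨0, 2 ^ K, by positivity⟩
  have hvol : ∀ Q : Seg, (volume Q.set).toReal = Q.l := fun Q => by
    rw [← measureReal_def, Seg.set, Real.volume_real_Ico_of_le (by linarith [Q.pos])]; ring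
  have hsub : ∀ Q : Seg, IsDyadicSubseg P Q → 0 ≤ Q.a := by
    rintro Q ⟨j, i, -, -, ha⟩
    have : Q.a = 0 + 2 ^ K * i / 2 ^ j := ha
    rw [this]
    positivity
  have hshort : ∀ Q : Seg, IsDyadicSubseg P Q → SegFree sparseSet Q → Q.l < 1 := by
    intro Q hQ hfree
    by_contra! h1
    obtain ⟨e, he, h2, h3⟩ := exists_mem_sparseSet_right (k := 0) (hsub Q hQ)
      (by simpa using hsub Q hQ)
    rw [pow_zero, div_one] at h3
    exact eq_empty_iff_forall_notMem.1 hfree e ⟨⟨h2, by linarith⟩, he⟩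
  have hmax : 1 / 2 ≤ maxFreeR sparseSet P := by
    refine le_csSup ⟨1, ?_⟩ ⟨⟨1 / 2, 1 / 2, by norm_num⟩, ⟨K + 1, 1, ?_, ?_, ?_⟩, ?_, ?_⟩
    · rintro v ⟨Q, hQ, hfree, rfl⟩
      rw [hvol]
      exact (hshort Q hQ hfree).le
    · exact Nat.one_lt_two_pow (by omega)
    · simp only [P, pow_succ]
      field_simp
    · simp only [P, pow_succ]
      field_simp
      simp
    · refine eq_empty_iff_forall_notMem.2 ?_
      rintro x ⟨⟨hx1, hx2⟩, hx⟩
      simp only at hx1 hx2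
      exact notMem_sparseSet_of_mem_Ioo ⟨by linarith, by linarith⟩ hx
    · rw [hvol]
  obtain ⟨N, Q, hQ, hdisj, hlarge, hsum⟩ := h P
  have hQsub : ∀ i, (Q i).set ⊆ Ico 0 (R + 1) := by
    intro i x hx
    have h0 := hsub _ (hQ i).1
    have h1 := hshort _ (hQ i).1 (hQ i).2
    have h2 := hlarge i
    rw [hvol] at h2
    refine ⟨h0.trans hx.1, ?_⟩
    by_contra! h3
    obtain ⟨e, he, h4, h5⟩ := exists_mem_sparseSet_right (k := k) h0
      (by have := hx.2; change R ≤ _; linarith)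
    have h6 : 1 / 2 ^ k < δ / 2 := by
      rw [div_lt_div_iff₀ (by positivity) two_pos]
      linarith
    have h7 : δ * (1 / 2) ≤ δ * maxFreeR sparseSet P := by gcongr
    exact eq_empty_iff_forall_notMem.1 (hQ i).2 e ⟨⟨h4, by linarith⟩, he⟩
  have h1 : ∑ i, (volume (Q i).set).toReal ≤ R + 1 := by
    calc ∑ i, (volume (Q i).set).toReal = volume.real (⋃ i, (Q i).set) :=
          (measureReal_iUnion_fintype (fun i j hij => hdisj i j hij)
            (fun _ => measurableSet_Ico) fun _ => measure_Ico_lt_top.ne).symm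
      _ ≤ volume.real (Ico 0 (R + 1)) :=
          measureReal_mono (iUnion_subset hQsub) measure_Ico_lt_top.ne
      _ = R + 1 := by
          rw [Real.volume_real_Ico_of_le (by positivity)]; ring
  rw [hvol] at hsum
  have : P.l = 2 ^ K := rfl
  rw [this] at hsum
  linarith

lemma hFreeR_sparseSet_mem {R : ℝ} (hR : 1 ≤ R) : hFreeR sparseSet 0 R ∈ Icc (1 / 2) 1 := by
  have hbdd : ∀ t ∈ {t : ℝ | ∃ y ∈ ball 0 R, ball y t ⊆ ball 0 R \ sparseSet}, t ≤ 1 := by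
    rintro t ⟨y, -, hsub⟩
    by_contra! h
    obtain ⟨e, he, hd⟩ := (infDist_lt_iff ⟨0, zero_mem_sparseSet⟩).1 (infDist_sparseSet_lt_one y)
    exact (hsub (mem_ball'.2 (hd.trans h))).2 he
  refine ⟨le_csSup ⟨1, hbdd⟩ ⟨1 / 2, ?_, fun x hx => ?_⟩, Real.sSup_le hbdd zero_le_one⟩
  · rw [mem_ball, Real.dist_eq]
    norm_num
    linarith
  · rw [Real.ball_eq_Ioo] at hx
    norm_num at hx
    refine ⟨?_, notMem_sparseSet_of_mem_Ioo hx⟩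
    rw [mem_ball, Real.dist_eq, sub_zero, abs_of_pos hx.1]
    linarith [hx.2]

lemma nonpos_of_mem_muckSetR_sparseSet {α : ℝ} (h : α ∈ MuckSetR sparseSet) : α ≤ 0 := by
  obtain ⟨C, hC⟩ := h
  by_contra! hα
  obtain ⟨k, hk2, hk⟩ := exists_lt_two_pow_rpow hα (4 * |C| * 2 ^ α)
  set R : ℝ := 2 ^ 2 ^ k
  have hR : 2 ≤ R := two_le_two_pow_two_pow k
  have hk4 : (4 : ℝ) ≤ 2 ^ k := by
    calc (4 : ℝ) = 2 ^ 2 := by norm_num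
      _ ≤ 2 ^ k := pow_le_pow_right₀ one_le_two hk2
  obtain ⟨hh1, hh2⟩ := hFreeR_sparseSet_mem (R := 2 * R) (by linarith)
  set t := hFreeR sparseSet 0 (2 * R)
  have h2k : (0 : ℝ) < 1 / 2 ^ k := by positivity
  have h1 := hC 0 zero_mem_sparseSet (2 * R) (1 / 2 ^ k) h2k (by
    refine lt_of_lt_of_le ?_ hh1
    rw [div_lt_div_iff₀ (by positivity) two_pos]
    linarith) (by linarith)
  have h2 : R ≤ (volume (thickening (1 / 2 ^ k) sparseSet ∩ ball 0 (2 * R))).toReal := by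
    calc R = volume.real (Ico R (2 * R)) := by
          rw [Real.volume_real_Ico_of_le (by linarith)]; ring
      _ ≤ _ := by
          refine measureReal_mono (fun x hx => ⟨?_, ?_⟩)
            ((measure_mono inter_subset_right).trans_lt measure_ball_lt_top).ne
          · rw [mem_thickening_iff_infDist_lt ⟨0, zero_mem_sparseSet⟩]
            refine infDist_sparseSet_lt ?_
            rw [abs_of_nonneg (by linarith [hx.1])]
            linarith [hx.1]
          · rw [mem_ball, Real.dist_eq, sub_zero, abs_of_nonneg (by linarith [hx.1])]
            exact hx.2
  have h3 : (t / (1 / 2 ^ k)) ^ (-α) ≤ 2 ^ α / ((2 : ℝ) ^ k) ^ α := by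
    have h4 : (2 : ℝ) ^ k / 2 ≤ t / (1 / 2 ^ k) := by
      rw [div_div_eq_mul_div, div_one]
      have := mul_le_mul_of_nonneg_right hh1 (by positivity : (0 : ℝ) ≤ 2 ^ k)
      linarith
    refine (Real.rpow_le_rpow_of_nonpos (by positivity) h4 (neg_nonpos.2 hα.le)).trans_eq ?_
    rw [Real.rpow_neg (by positivity), ← Real.inv_rpow (by positivity), inv_div,
      Real.div_rpow (by positivity) (by positivity)]
  have h5 : (volume (ball (0 : ℝ) (2 * R))).toReal = 4 * R := by
    rw [← measureReal_def, Real.volume_real_ball (by linarith)]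
    ring
  have h6 : C * (t / (1 / 2 ^ k)) ^ (-α) ≤ |C| * (2 ^ α / ((2 : ℝ) ^ k) ^ α) :=
    mul_le_mul (le_abs_self C) h3 (by positivity) (abs_nonneg C)
  have h7 : R ≤ |C| * (2 ^ α / ((2 : ℝ) ^ k) ^ α) * (4 * R) := by
    rw [h5] at h1
    exact (h2.trans h1).trans (by gcongr)
  have h8 : (0 : ℝ) < ((2 : ℝ) ^ k) ^ α := by positivity
  have h9 : |C| * (2 ^ α / ((2 : ℝ) ^ k) ^ α) * (4 * R) =
      4 * |C| * 2 ^ α / ((2 : ℝ) ^ k) ^ α * R := by ring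
  have h10 : 4 * |C| * 2 ^ α / ((2 : ℝ) ^ k) ^ α < 1 := (div_lt_one h8).2 hk
  nlinarith

lemma muckExpR_sparseSet : MuckExpR sparseSet = 0 := by
  rw [MuckExpR]
  split_ifs
  · have hzero : (0 : ℝ) ∈ MuckSetR sparseSet := ⟨1, fun x _ R r _ _ _ => by
      rw [neg_zero, Real.rpow_zero, one_mul, one_mul]
      exact ENNReal.toReal_mono measure_ball_lt_top.ne (measure_mono inter_subset_right)⟩
    exact IsGreatest.csSup_eq ⟨hzero, fun α hα => nonpos_of_mem_muckSetR_sparseSet hα⟩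
  · rfl

/-- There exists a closed set `E ⊆ ℝ` (as constructed in the paper with
dilation factors `tₙ = 1 - 1/(2n)`) such that for every `0 < α < 1` and `1 < p < ∞`,
the weight `dist(·,E)^{-α}` belongs to `A_p(ℝ)` but not to `A₁(ℝ)`; consequently
`E` is not weakly porous and `Mu(E) = 0`. -/
theorem exists_ap_not_a1_distance_set :
    ∃ E : Set ℝ, IsClosed E ∧ E.Nonempty ∧
      (∀ α p : ℝ, 0 < α → α < 1 → 1 < p →
        MemApR (fun x => infDist x E ^ (-α)) p ∧
        ¬ MemA1R (fun x => infDist x E ^ (-α))) ∧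
      ¬ WeaklyPorousR E ∧ MuckExpR E = 0 :=
  ⟨sparseSet, isClosed_sparseSet, ⟨0, zero_mem_sparseSet⟩,
    fun _ _ hα hα1 hp => ⟨memApR_infDist_sparseSet hα hα1 hp, not_memA1R_infDist_sparseSet hα⟩,
    not_weaklyPorousR_sparseSet, muckExpR_sparseSet⟩
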